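/- Let C be a d-arrangement of k ≥ 3 curves in ℂP² and G its Levi graph, with binomial edge ideal J_G in S = K[x_v, y_v : v ∈ V(G)]. Then S/J_G is never Cohen–Macaulay. -/

import Mathlib

open MvPolynomial

/-- The Levi graph of an arrangement of curves `C : ι → Set P` with singular points `S`:
the bipartite incidence graph between singular points and curves. -/
def leviGraph {P ι : Type*} (C : ι → Set P) (S : Finset P) :
    SimpleGraph ({p // p ∈ S} ⊕ ι) :=
  SimpleGraph.fromRel (fun u v => ∃ (p : {p // p ∈ S}) (i : ι),
    u = Sum.inl p ∧ v = Sum.inr i ∧ (p : P) ∈ C i)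

/-- The binomial edge ideal of a simple graph `G`, in the polynomial ring with two
variables `x_v = X (Sum.inl v)` and `y_v = X (Sum.inr v)` for each vertex `v`. -/
noncomputable def binomialEdgeIdeal {V : Type*} (K : Type*) [Field K] (G : SimpleGraph V) :
    Ideal (MvPolynomial (V ⊕ V) K) :=
  Ideal.span {f | ∃ u v : V, G.Adj u v ∧
    f = X (Sum.inl u) * X (Sum.inr v) - X (Sum.inl v) * X (Sum.inr u)}

/-- The depth of `S ⧸ J` with respect to the irrelevant maximal ideal generated by the
variables, defined as the supremum of lengths of regular sequences on `S ⧸ J` consisting of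
elements of that ideal. -/
noncomputable def quotDepth {σ : Type*} (K : Type*) [Field K]
    (J : Ideal (MvPolynomial σ K)) : ℕ :=
  sSup {n : ℕ | ∃ rs : List (MvPolynomial σ K), rs.length = n ∧
    (∀ r ∈ rs, r ∈ Ideal.span (Set.range (X : σ → MvPolynomial σ K))) ∧
    RingTheory.Sequence.IsRegular (MvPolynomial σ K ⧸ J) rs}

/-- `S ⧸ J` is Cohen–Macaulay: its Krull dimension equals its depth. -/
def quotIsCM {σ : Type*} (K : Type*) [Field K] (J : Ideal (MvPolynomial σ K)) : Prop :=
  ringKrullDim (MvPolynomial σ K ⧸ J) = ((quotDepth K J : ℕ) : WithBot (WithTop ℕ))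


open scoped Pointwise in
theorem exists_assoc_lt {R : Type*} [CommRing R] [IsNoetherianRing R] {M : Type*}
    [AddCommGroup M] [Module R M] [Module.Finite R M] (m : Ideal R) (hm : m.IsPrime)
    {r : R} (hr : r ∈ m) (hreg : IsSMulRegular M r) {P : Ideal R}
    (hP : P ∈ associatedPrimes R M) (hPm : P ≤ m) :
    ∃ Q ∈ associatedPrimes R (QuotSMulTop r M), P < Q ∧ Q ≤ m := by
  have hP' := hP
  rw [AssociatedPrimes.mem_iff, isAssociatedPrime_iff] at hP'
  obtain ⟨hPp, y, hy⟩ := hP'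
  have hyP : ∀ a, a ∈ P ↔ a • y = 0 := by
    intro a
    rw [hy, Submodule.mem_colon_singleton, Submodule.mem_bot]
  let N : Submodule R M :=
    { carrier := {x | ∀ a ∈ P, a • x = 0}
      add_mem' := by
        intro x z hx hz a ha
        rw [smul_add, hx a ha, hz a ha, add_zero]
      zero_mem' := by intro a _; exact smul_zero a
      smul_mem' := by
        intro c x hx a ha
        rw [smul_comm, hx a ha, smul_zero] }
  have hyN : y ∈ N := fun a ha => (hyP a).1 ha
  let Nb : Submodule R (QuotSMulTop r M) := N.map (Submodule.mkQ _)
  have hrP : r ∉ P := by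
    intro h
    have h1 : r • y = r • 0 := by rw [(hyP r).1 h, smul_zero]
    have h2 : y = 0 := hreg h1
    exact hPp.ne_top ((Ideal.eq_top_iff_one _).2 ((hyP 1).2 (by rw [h2, smul_zero])))
  have hann : Module.annihilator R Nb ≤ m := by
    intro s hs
    by_contra hsm
    have hsN : ∀ x ∈ N, ∃ z ∈ N, s • x = r • z := by
      intro x hx
      have h1 := (Module.mem_annihilator.1 hs)
        ⟨Submodule.mkQ _ x, Submodule.mem_map_of_mem hx⟩
      have h2 : Submodule.mkQ (r • (⊤ : Submodule R M)) (s • x) = 0 := by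
        rw [map_smul]; exact congrArg Subtype.val h1
      rw [Submodule.mkQ_apply, Submodule.Quotient.mk_eq_zero] at h2
      obtain ⟨z, -, hz⟩ := (Submodule.mem_smul_pointwise_iff_exists _ _ _).1 h2
      refine ⟨z, ?_, hz.symm⟩
      intro a ha
      apply hreg
      change r • a • z = r • 0
      rw [smul_comm, hz, smul_comm, hx a ha, smul_zero, smul_zero]
    have hrange : LinearMap.range (algebraMap R (Module.End R N) s) ≤
        Ideal.span {r} • (⊤ : Submodule R N) := by
      rintro _ ⟨x, rfl⟩
      obtain ⟨z, hz, hxz⟩ := hsN x.1 x.2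
      have : (algebraMap R (Module.End R N) s) x = r • (⟨z, hz⟩ : N) := by
        ext; simpa using hxz
      rw [this]
      exact Submodule.smul_mem_smul (Ideal.mem_span_singleton_self r) trivial
    obtain ⟨p, hpm, -, hpc, hp0⟩ :=
      LinearMap.exists_monic_and_natDegree_eq_and_coeff_mem_pow_and_aeval_eq_zero R
        (algebraMap R (Module.End R N) s) _ hrange
    rw [Polynomial.aeval_algebraMap_apply] at hp0
    have h3 : p.eval s ∈ P := by
      rw [hyP]
      have := congrArg (fun f : Module.End R N => (f ⟨y, hyN⟩ : M)) hp0
      simpa using this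
    have h4 := hPm h3
    rw [Polynomial.eval_eq_sum_range, Finset.sum_range_succ] at h4
    have h5 : ∑ x ∈ Finset.range p.natDegree, p.coeff x * s ^ x ∈ m := by
      refine Ideal.sum_mem _ fun i hi => Ideal.mul_mem_right _ _ ?_
      have h6 := Ideal.pow_le_self (by have := Finset.mem_range.1 hi; omega) (hpc i)
      exact ((Ideal.span_singleton_le_iff_mem _).2 hr) h6
    have h7 := (Ideal.add_mem_iff_right _ h5).1 h4
    rw [hpm.coeff_natDegree, one_mul] at h7
    exact hsm (hm.mem_of_pow_mem _ h7)
  obtain ⟨Q, hQ, hQm⟩ := Ideal.exists_minimalPrimes_le hann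
  refine ⟨Q, associatedPrimes.subset_of_injective (f := Nb.subtype) Nb.injective_subtype
    (Module.associatedPrimes.minimalPrimes_annihilator_subset_associatedPrimes R Nb hQ), ?_, hQm⟩
  have hr' : r ∈ Q := by
    apply hQ.1.2
    rw [Module.mem_annihilator]
    rintro ⟨_, x, hx, rfl⟩
    ext
    change r • Submodule.mkQ (r • (⊤ : Submodule R M)) x = 0
    rw [← map_smul, Submodule.mkQ_apply, Submodule.Quotient.mk_eq_zero]
    exact Submodule.smul_mem_pointwise_smul _ _ _ trivial
  have hPQ : P ≤ Q := by
    intro a ha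
    apply hQ.1.2
    rw [Module.mem_annihilator]
    rintro ⟨_, x, hx, rfl⟩
    ext
    change a • Submodule.mkQ (r • (⊤ : Submodule R M)) x = 0
    rw [← map_smul, hx a ha, map_zero]
  exact lt_of_le_of_ne hPQ (fun h => hrP (h ▸ hr'))

theorem length_le_dim {R : Type*} [CommRing R] [IsNoetherianRing R] (m : Ideal R)
    (hm : m.IsPrime) (rs : List R) : ∀ {M : Type*}
    [AddCommGroup M] [Module R M] [Module.Finite R M] (_ : ∀ r ∈ rs, r ∈ m)
    (_ : RingTheory.Sequence.IsWeaklyRegular M rs) {P : Ideal R}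
    (_ : P ∈ associatedPrimes R M) (_ : P ≤ m),
    ((rs.length : ℕ) : WithBot ℕ∞) ≤ ringKrullDim (R ⧸ P) := by
  induction rs with
  | nil =>
    intro M _ _ _ _ _ P hP _
    have := hP.1
    simp only [List.length_nil, Nat.cast_zero]
    exact ringKrullDim_nonneg_of_nontrivial
  | cons r rs ih =>
    intro M _ _ _ hrs hreg P hP hPm
    rw [RingTheory.Sequence.isWeaklyRegular_cons_iff] at hreg
    obtain ⟨Q, hQ, hPQ, hQm⟩ := exists_assoc_lt m hm (hrs r (by simp)) hreg.1 hP hPm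
    have h1 := ih (fun r hr => hrs r (by simp [hr])) hreg.2 hQ hQm
    obtain ⟨a, haQ, haP⟩ := SetLike.exists_of_lt hPQ
    have := hP.1
    have h2 : ringKrullDim (R ⧸ Q) + 1 ≤ ringKrullDim (R ⧸ P) := by
      refine ringKrullDim_succ_le_of_surjective (Ideal.Quotient.factor hPQ.le)
        (Ideal.Quotient.factor_surjective hPQ.le) (r := Ideal.Quotient.mk P a) ?_ ?_
      · rw [mem_nonZeroDivisors_iff_ne_zero]
        rwa [Ne, Ideal.Quotient.eq_zero_iff_mem]
      · rw [Ideal.Quotient.factor_mk, Ideal.Quotient.eq_zero_iff_mem]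
        exact haQ
    refine le_trans ?_ h2
    rw [List.length_cons, Nat.cast_add, Nat.cast_one]
    gcongr

theorem quotDepth_le {σ K : Type*} [Field K] [Finite σ] (J P : Ideal (MvPolynomial σ K))
    (hP : P ∈ J.minimalPrimes) (hPm : ∀ f ∈ P, constantCoeff f = 0) (N : ℕ)
    (hN : ringKrullDim (MvPolynomial σ K ⧸ P) ≤ (N : WithBot ℕ∞)) : quotDepth K J ≤ N := by
  apply csSup_le'
  rintro n ⟨rs, rfl, hrs, hreg⟩
  have hass : P ∈ associatedPrimes (MvPolynomial σ K) (MvPolynomial σ K ⧸ J) := by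
    apply Module.associatedPrimes.minimalPrimes_annihilator_subset_associatedPrimes
    rwa [Ideal.annihilator_quotient]
  have h := length_le_dim (RingHom.ker (constantCoeff : MvPolynomial σ K →+* K))
    (RingHom.ker_isPrime _) rs (fun r hr => by
      refine Ideal.span_le.2 ?_ (hrs r hr)
      rintro _ ⟨i, rfl⟩
      simp [RingHom.mem_ker]) hreg.toIsWeaklyRegular hass (fun f hf => hPm f hf)
  exact_mod_cast h.trans hN

theorem dim_le_of_integral {A B : Type*} [CommRing A] [CommRing B] (g : A →+* B)
    (hg : g.IsIntegral) : ringKrullDim B ≤ ringKrullDim A := by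
  let _ : Algebra A B := g.toAlgebra
  have : Algebra.IsIntegral A B := ⟨hg⟩
  refine Order.krullDim_le_of_strictMono (PrimeSpectrum.comap (algebraMap A B)) ?_
  intro I J hIJ
  exact Ideal.IsIntegral.comap_lt_comap (R := A) (A := B) (I := I.asIdeal) (J := J.asIdeal) hIJ

theorem dim_quot_ker_le {σ τ K : Type*} [Field K] [Finite σ] [Finite τ]
    (φ : MvPolynomial σ K →ₐ[K] MvPolynomial τ K) :
    ringKrullDim (MvPolynomial σ K ⧸ RingHom.ker φ) ≤ (Nat.card τ : WithBot ℕ∞) := by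
  have : Nontrivial (MvPolynomial σ K ⧸ RingHom.ker φ) :=
    Ideal.Quotient.nontrivial_iff.2 (RingHom.ker_ne_top _)
  obtain ⟨s, g, hinj, hint⟩ := exists_integral_inj_algHom_of_fg K
    (MvPolynomial σ K ⧸ RingHom.ker φ)
  refine (dim_le_of_integral g.toRingHom hint).trans ?_
  have hs : s ≤ Nat.card τ := by
    let h : MvPolynomial (Fin s) K →ₐ[K] MvPolynomial τ K := (Ideal.kerLiftAlg φ).comp g
    have hh : Function.Injective h := (Ideal.kerLiftAlg_injective φ).comp hinj
    have := lift_trdeg_le_of_injective h hh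
    rw [MvPolynomial.trdeg_of_isDomain, MvPolynomial.trdeg_of_isDomain] at this
    have := Fintype.ofFinite τ
    simp at *
    exact_mod_cast this
  rw [MvPolynomial.ringKrullDim_of_isNoetherianRing]
  simp
  exact_mod_cast hs

/-- generic parametrization -/
noncomputable def phi (V K : Type*) [Field K] :
    MvPolynomial (V ⊕ V) K →ₐ[K] MvPolynomial (Option V) K :=
  aeval (Sum.elim (fun v => X (some v)) (fun v => X none * X (some v)))

theorem phi_ge {V K : Type*} [Field K] (G : SimpleGraph V) :
    binomialEdgeIdeal K G ≤ RingHom.ker (phi V K) := by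
  refine Ideal.span_le.2 ?_
  rintro _ ⟨u, v, -, rfl⟩
  simp only [SetLike.mem_coe, RingHom.mem_ker, phi, map_sub, map_mul, aeval_X, Sum.elim_inl,
    Sum.elim_inr]
  ring

theorem dim_ge_card_succ {V K : Type*} [Field K] [Finite V] [Nonempty V] (G : SimpleGraph V) :
    ((Nat.card V + 1 : ℕ) : WithBot ℕ∞) ≤
      ringKrullDim (MvPolynomial (V ⊕ V) K ⧸ binomialEdgeIdeal K G) := by
  refine le_trans ?_ (ringKrullDim_le_of_surjective (Ideal.Quotient.factor (phi_ge G))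
    (Ideal.Quotient.factor_surjective _))
  let ψ : MvPolynomial (Option V) K →ₐ[K] MvPolynomial V K :=
    aeval (fun o => o.elim 0 X)
  let χ : MvPolynomial (V ⊕ V) K ⧸ RingHom.ker (phi V K) →+* MvPolynomial V K :=
    ψ.toRingHom.comp (Ideal.kerLiftAlg (phi V K)).toRingHom
  have hχ : Function.Surjective χ := by
    intro f
    refine ⟨Ideal.Quotient.mk _ (rename Sum.inl f), ?_⟩
    change ψ (phi V K (rename Sum.inl f)) = f
    rw [phi, aeval_rename]
    have : (ψ.comp (aeval (Sum.elim (fun v => X (some v)) (fun v => X none * X (some v)) ∘ Sum.inl))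
      : MvPolynomial V K →ₐ[K] MvPolynomial V K) = AlgHom.id K _ := by
      ext v : 1
      simp [ψ]
    exact DFunLike.congr_fun this f
  obtain ⟨v⟩ := ‹Nonempty V›
  have : (RingHom.ker (phi V K)).IsPrime := RingHom.ker_isPrime _
  have h := ringKrullDim_succ_le_of_surjective χ hχ
    (r := Ideal.Quotient.mk _ (X (Sum.inr v))) ?_ ?_
  · refine le_trans ?_ h
    rw [MvPolynomial.ringKrullDim_of_isNoetherianRing]
    simp
  · rw [mem_nonZeroDivisors_iff_ne_zero, Ne, Ideal.Quotient.eq_zero_iff_mem, RingHom.mem_ker, phi,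
      aeval_X]
    exact mul_ne_zero (X_ne_zero _) (X_ne_zero _)
  · change ψ (phi V K (X (Sum.inr v))) = 0
    simp [phi, ψ]

theorem phi_minimal {V K : Type*} [Field K] (G : SimpleGraph V) (c : V)
    (hc : ∀ v, v ≠ c → G.Adj c v) :
    RingHom.ker (phi V K) ∈ (binomialEdgeIdeal K G).minimalPrimes := by
  refine ⟨⟨RingHom.ker_isPrime _, phi_ge G⟩, ?_⟩
  rintro Q ⟨hQ, hJQ⟩ hQP f hf
  let L := FractionRing (MvPolynomial (V ⊕ V) K ⧸ Q)
  let π : MvPolynomial (V ⊕ V) K →ₐ[K] L :=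
    (IsScalarTower.toAlgHom K (MvPolynomial (V ⊕ V) K ⧸ Q) L).comp (Ideal.Quotient.mkₐ K Q)
  have hπ : ∀ f, π f = 0 ↔ f ∈ Q := by
    intro f
    change algebraMap _ L (Ideal.Quotient.mk Q f) = 0 ↔ _
    rw [FaithfulSMul.algebraMap_eq_zero_iff, Ideal.Quotient.eq_zero_iff_mem]
  have hxc : π (X (Sum.inl c)) ≠ 0 := by
    rw [Ne, hπ]
    intro h
    have := hQP h
    rw [RingHom.mem_ker, phi, aeval_X] at this
    exact X_ne_zero _ this
  let θ : MvPolynomial (Option V) K →ₐ[K] L :=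
    aeval (fun o => o.elim (π (X (Sum.inr c)) / π (X (Sum.inl c))) (fun v => π (X (Sum.inl v))))
  have hθ : θ.comp (phi V K) = π := by
    ext v : 1
    rcases v with v | v
    · simp [θ, phi]
    · by_cases hv : v = c
      · subst hv
        simp only [phi, θ, AlgHom.comp_apply, aeval_X, Sum.elim_inr, map_mul, Option.elim]
        exact div_mul_cancel₀ _ hxc
      · have h1 : X (Sum.inl c) * X (Sum.inr v) - X (Sum.inl v) * X (Sum.inr c) ∈ Q :=
          hJQ (Ideal.subset_span ⟨c, v, hc v hv, rfl⟩)
        rw [← hπ, map_sub, map_mul, map_mul, sub_eq_zero] at h1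
        simp only [phi, θ, AlgHom.comp_apply, aeval_X, Sum.elim_inr, map_mul, Option.elim]
        rw [div_mul_eq_mul_div, div_eq_iff hxc, mul_comm, ← h1, mul_comm]
  rw [← hπ, ← hθ, AlgHom.comp_apply]
  rw [RingHom.mem_ker] at hf
  rw [hf, map_zero]

/-- killing the variables of the vertices outside the range of `Sum.inl`. -/
noncomputable def kill {V W : Type*} (K : Type*) [Field K] (e : V → Option W) :
    MvPolynomial (V ⊕ V) K →ₐ[K] MvPolynomial (W ⊕ W) K :=
  aeval (Sum.elim (fun v => (e v).elim 0 (fun w => X (Sum.inl w)))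
    (fun v => (e v).elim 0 (fun w => X (Sum.inr w))))

theorem kill_ge {V W K : Type*} [Field K] (e : V → Option W) (G : SimpleGraph V)
    (he : ∀ u v, G.Adj u v → e u = none ∨ e v = none) :
    binomialEdgeIdeal K G ≤ RingHom.ker (kill K e) := by
  refine Ideal.span_le.2 ?_
  rintro _ ⟨u, v, h, rfl⟩
  simp only [SetLike.mem_coe, RingHom.mem_ker, kill, map_sub, map_mul, aeval_X, Sum.elim_inl,
    Sum.elim_inr]
  rcases he u v h with h | h <;> simp [h]

theorem kill_dim_ge {V W K : Type*} [Field K] [Finite W] (e : V → Option W) (G : SimpleGraph V)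
    (he : ∀ u v, G.Adj u v → e u = none ∨ e v = none) (s : W → V) (hs : ∀ w, e (s w) = some w) :
    ((2 * Nat.card W : ℕ) : WithBot ℕ∞) ≤
      ringKrullDim (MvPolynomial (V ⊕ V) K ⧸ binomialEdgeIdeal K G) := by
  have hsurj : Function.Surjective
      (Ideal.Quotient.lift _ (kill K e).toRingHom (fun a ha => kill_ge e G he ha) :
        MvPolynomial (V ⊕ V) K ⧸ binomialEdgeIdeal K G →+* _) := by
    apply Ideal.Quotient.lift_surjective_of_surjective
    intro f
    refine ⟨rename (Sum.map s s) f, ?_⟩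
    change kill K e _ = f
    have : (kill K e).comp (rename (Sum.map s s)) = AlgHom.id K _ := by
      ext v : 1
      rcases v with v | v <;> simp [kill, hs]
    exact DFunLike.congr_fun this f
  refine le_trans ?_ (ringKrullDim_le_of_surjective _ hsurj)
  rw [MvPolynomial.ringKrullDim_of_isNoetherianRing]
  simp [two_mul, Nat.card_sum]

theorem kill_constantCoeff {V W K : Type*} [Field K] (e : V → Option W) (f)
    (hf : f ∈ RingHom.ker (kill K e)) : constantCoeff f = 0 := by
  have : (constantCoeff (σ := W ⊕ W) (R := K)).comp (kill K e).toRingHom = constantCoeff := by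
    apply MvPolynomial.ringHom_ext
    · intro a; simp [kill]
    · rintro (v | v) <;> cases h : e v <;> simp [kill, h]
  rw [← this]
  change constantCoeff (kill K e f) = 0
  rw [RingHom.mem_ker] at hf
  rw [hf, map_zero]

theorem phi_constantCoeff {V K : Type*} [Field K] (f)
    (hf : f ∈ RingHom.ker (phi V K)) : constantCoeff f = 0 := by
  have : (constantCoeff (σ := Option V) (R := K)).comp (phi V K).toRingHom = constantCoeff := by
    apply MvPolynomial.ringHom_ext
    · intro a; simp [phi]
    · rintro (v | v) <;> simp [phi]
  rw [← this]
  change constantCoeff (phi V K f) = 0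
  rw [RingHom.mem_ker] at hf
  rw [hf, map_zero]

theorem kill_minimal {V W K : Type*} [Field K] (e : V → Option W) (G : SimpleGraph V)
    (he : ∀ u v, G.Adj u v → e u = none ∨ e v = none) (s : W → V) (hs : ∀ w, e (s w) = some w)
    (hs' : ∀ v w, e v = some w → v = s w)
    (hdeg : ∀ v, e v = none → ∃ a b, a ≠ b ∧ G.Adj v (s a) ∧ G.Adj v (s b)) :
    RingHom.ker (kill K e) ∈ (binomialEdgeIdeal K G).minimalPrimes := by
  refine ⟨⟨RingHom.ker_isPrime _, kill_ge e G he⟩, ?_⟩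
  rintro Q ⟨hQ, hJQ⟩ hQP f hf
  have key : ∀ v, e v = none →
      (X (Sum.inl v) : MvPolynomial (V ⊕ V) K) ∈ Q ∧
      (X (Sum.inr v) : MvPolynomial (V ⊕ V) K) ∈ Q := by
    intro v hv
    obtain ⟨a, b, hab, ha, hb⟩ := hdeg v hv
    have h1 : X (Sum.inl v) * X (Sum.inr (s a)) - X (Sum.inl (s a)) * X (Sum.inr v) ∈ Q :=
      hJQ (Ideal.subset_span ⟨v, s a, ha, rfl⟩)
    have h2 : X (Sum.inl v) * X (Sum.inr (s b)) - X (Sum.inl (s b)) * X (Sum.inr v) ∈ Q :=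
      hJQ (Ideal.subset_span ⟨v, s b, hb, rfl⟩)
    have h3 : (X (Sum.inr (s a)) * X (Sum.inl (s b)) - X (Sum.inl (s a)) * X (Sum.inr (s b)) :
        MvPolynomial (V ⊕ V) K) ∉ Q := by
      intro h
      have h4 := hQP h
      rw [RingHom.mem_ker] at h4
      simp only [kill, map_sub, map_mul, aeval_X, Sum.elim_inl, Sum.elim_inr, hs,
        Option.elim] at h4
      classical
      have h5 := congrArg (aeval (Sum.elim (fun w => if w = b then (1 : K) else 0)
        (fun w => if w = a then (1 : K) else 0))) h4
      simp [hab, hab.symm] at h5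
    constructor
    · refine (hQ.mem_or_mem (y := X (Sum.inr (s a)) * X (Sum.inl (s b)) -
        X (Sum.inl (s a)) * X (Sum.inr (s b))) ?_).resolve_right h3
      have := Q.sub_mem (Q.mul_mem_left (X (Sum.inl (s b))) h1)
        (Q.mul_mem_left (X (Sum.inl (s a))) h2)
      convert this using 1
      ring
    · refine (hQ.mem_or_mem (y := X (Sum.inr (s a)) * X (Sum.inl (s b)) -
        X (Sum.inl (s a)) * X (Sum.inr (s b))) ?_).resolve_right h3
      have := Q.sub_mem (Q.mul_mem_left (X (Sum.inr (s b))) h1)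
        (Q.mul_mem_left (X (Sum.inr (s a))) h2)
      convert this using 1
      ring
  have hfac : ((Ideal.Quotient.mkₐ K Q).comp (rename (Sum.map s s))).comp (kill K e) =
      Ideal.Quotient.mkₐ K Q := by
    ext v : 1
    rcases v with v | v
    · cases h : e v with
      | none =>
        have := (Ideal.Quotient.eq_zero_iff_mem).2 (key v h).1
        simp [kill, h, this]
      | some w => simp [kill, hs' v w h, hs]
    · cases h : e v with
      | none =>
        have := (Ideal.Quotient.eq_zero_iff_mem).2 (key v h).2
        simp [kill, h, this]
      | some w => simp [kill, hs' v w h, hs]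
  rw [← Ideal.Quotient.eq_zero_iff_mem, ← Ideal.Quotient.mkₐ_eq_mk K, ← hfac, AlgHom.comp_apply]
  rw [RingHom.mem_ker] at hf
  rw [hf, map_zero]

theorem kill_depth {V W K : Type*} [Field K] [Finite V] [Finite W] (e : V → Option W)
    (G : SimpleGraph V)
    (he : ∀ u v, G.Adj u v → e u = none ∨ e v = none) (s : W → V) (hs : ∀ w, e (s w) = some w)
    (hs' : ∀ v w, e v = some w → v = s w)
    (hdeg : ∀ v, e v = none → ∃ a b, a ≠ b ∧ G.Adj v (s a) ∧ G.Adj v (s b)) :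
    quotDepth K (binomialEdgeIdeal K G) ≤ 2 * Nat.card W := by
  refine quotDepth_le _ _ (kill_minimal e G he s hs hs' hdeg) (kill_constantCoeff e) _ ?_
  refine (dim_quot_ker_le _).trans ?_
  simp [two_mul, Nat.card_sum]

theorem star_depth {V K : Type*} [Field K] [Finite V] (G : SimpleGraph V) (c : V)
    (hc : ∀ v, v ≠ c → G.Adj c v) :
    quotDepth K (binomialEdgeIdeal K G) ≤ Nat.card V + 1 := by
  refine quotDepth_le _ _ (phi_minimal G c hc) phi_constantCoeff _ ?_
  refine (dim_quot_ker_le _).trans ?_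
  simp [Finite.card_option]

theorem leviGraph_d_arrangement_not_CM {P : Type*} {k d : ℕ}
    (hk : 3 ≤ k) (hd : 1 ≤ d) (C : Fin k → Set P) (S : Finset P)
    (hS : ∀ p : P, p ∈ S ↔ ∃ i j : Fin k, i ≠ j ∧ p ∈ C i ∧ p ∈ C j)
    (hpair : ∀ i j : Fin k, i ≠ j → (C i ∩ C j).ncard = d ^ 2)
    (K : Type*) [Field K] :
    ¬ quotIsCM K (binomialEdgeIdeal K (leviGraph C S)) := by
  intro hCM
  replace hCM : ringKrullDim (MvPolynomial _ K ⧸ binomialEdgeIdeal K (leviGraph C S)) =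
    ((quotDepth K (binomialEdgeIdeal K (leviGraph C S)) : ℕ) : WithBot ℕ∞) := hCM
  have adj1 : ∀ (p : {p // p ∈ S}) (i : Fin k), (p : P) ∈ C i →
      (leviGraph C S).Adj (Sum.inl p) (Sum.inr i) := by
    intro p i h
    rw [leviGraph, SimpleGraph.fromRel_adj]
    exact ⟨by simp, Or.inl ⟨p, i, rfl, rfl, h⟩⟩
  have adjcases : ∀ u v, (leviGraph C S).Adj u v →
      (u.isLeft ∧ v.isRight) ∨ (u.isRight ∧ v.isLeft) := by
    intro u v h
    rw [leviGraph, SimpleGraph.fromRel_adj] at h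
    rcases h.2 with ⟨p, i, rfl, rfl, -⟩ | ⟨p, i, rfl, rfl, -⟩ <;> simp
  have hmeet : ∀ i j : Fin k, i ≠ j → ∃ p ∈ S, p ∈ C i ∧ p ∈ C j := by
    intro i j hij
    have h1 : (C i ∩ C j).ncard ≠ 0 := by
      rw [hpair i j hij]; positivity
    obtain ⟨p, hp⟩ := Set.nonempty_of_ncard_ne_zero h1
    exact ⟨p, (hS p).2 ⟨i, j, hij, hp.1, hp.2⟩, hp.1, hp.2⟩
  have hother : ∀ i : Fin k, ∃ j, j ≠ i := by
    intro i
    have : Nontrivial (Fin k) := Fin.nontrivial_iff_two_le.2 (by omega)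
    exact exists_ne i
  -- the two coordinate projections
  let e1 : {p // p ∈ S} ⊕ Fin k → Option (Fin k) := Sum.elim (fun _ => none) some
  let e2 : {p // p ∈ S} ⊕ Fin k → Option {p // p ∈ S} := Sum.elim some (fun _ => none)
  have he1 : ∀ u v, (leviGraph C S).Adj u v → e1 u = none ∨ e1 v = none := by
    intro u v h
    have h' := adjcases u v h
    rcases u with u | u <;> rcases v with v | v <;> simp at h' <;> simp [e1]
  have he2 : ∀ u v, (leviGraph C S).Adj u v → e2 u = none ∨ e2 v = none := by
    intro u v h
    have h' := adjcases u v h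
    rcases u with u | u <;> rcases v with v | v <;> simp at h' <;> simp [e2]
  by_cases hleaf : ∀ i : Fin k, ∃ p q : {p // p ∈ S}, p ≠ q ∧ (p : P) ∈ C i ∧ (q : P) ∈ C i
  · have d1 : quotDepth K (binomialEdgeIdeal K (leviGraph C S)) ≤ 2 * Nat.card (Fin k) := by
      refine kill_depth e1 _ he1 Sum.inr (fun w => rfl) ?_ ?_
      · rintro (v | v) w h <;> simp [e1] at h <;> rw [h]
      · rintro (v | v) h
        · obtain ⟨i, j, hij, hi, hj⟩ := (hS v).1 v.2
          exact ⟨i, j, hij, adj1 v i hi, adj1 v j hj⟩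
        · simp [e1] at h
    have d2 : quotDepth K (binomialEdgeIdeal K (leviGraph C S)) ≤
        2 * Nat.card {p // p ∈ S} := by
      refine kill_depth e2 _ he2 Sum.inl (fun w => rfl) ?_ ?_
      · rintro (v | v) w h <;> simp [e2] at h <;> rw [h]
      · rintro (v | v) h
        · simp [e2] at h
        · obtain ⟨p, q, hpq, hp, hq⟩ := hleaf v
          exact ⟨p, q, hpq, (adj1 p v hp).symm, (adj1 q v hq).symm⟩
    have : Nonempty ({p // p ∈ S} ⊕ Fin k) := ⟨Sum.inr ⟨0, by omega⟩⟩
    have d3 := dim_ge_card_succ (K := K) (leviGraph C S)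
    rw [hCM] at d3
    have d4 : Nat.card ({p // p ∈ S} ⊕ Fin k) + 1 ≤
        quotDepth K (binomialEdgeIdeal K (leviGraph C S)) := by exact_mod_cast d3
    rw [Nat.card_sum] at d4
    omega
  · push Not at hleaf
    obtain ⟨i, hi⟩ := hleaf
    obtain ⟨j, hj⟩ := hother i
    obtain ⟨p, hpS, hpi, -⟩ := hmeet i j hj.symm
    have huniq : ∀ q ∈ S, q ∈ C i → q = p := by
      intro q hq hqi
      by_contra hne
      exact hi ⟨q, hq⟩ ⟨p, hpS⟩ (by simpa using hne) hqi hpi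
    have hall : ∀ l, p ∈ C l := by
      intro l
      by_cases hl : l = i
      · exact hl ▸ hpi
      · obtain ⟨q, hq, hqi, hql⟩ := hmeet i l (Ne.symm hl)
        exact huniq q hq hqi ▸ hql
    have hd1 : d ^ 2 = 1 := by
      rw [← hpair i j hj.symm]
      rw [Set.ncard_eq_one]
      refine ⟨p, Set.eq_singleton_iff_unique_mem.2 ⟨⟨hpi, hall j⟩, ?_⟩⟩
      rintro q ⟨hqi, hqj⟩
      exact huniq q ((hS q).2 ⟨i, j, hj.symm, hqi, hqj⟩) hqi
    have hSp : ∀ q : {p // p ∈ S}, q = ⟨p, hpS⟩ := by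
      rintro ⟨q, hq⟩
      obtain ⟨a, b, hab, ha, hb⟩ := (hS q).1 hq
      have h1 := hpair a b hab
      rw [hd1, Set.ncard_eq_one] at h1
      obtain ⟨z, hz⟩ := h1
      have h2 : q ∈ ({z} : Set P) := hz ▸ ⟨ha, hb⟩
      have h3 : p ∈ ({z} : Set P) := hz ▸ ⟨hall a, hall b⟩
      ext
      exact h2.trans h3.symm
    have hcard : Nat.card {p // p ∈ S} = 1 := by
      rw [Nat.card_eq_one_iff_exists]
      exact ⟨_, hSp⟩
    have d1 : quotDepth K (binomialEdgeIdeal K (leviGraph C S)) ≤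
        Nat.card ({p // p ∈ S} ⊕ Fin k) + 1 := by
      refine star_depth _ (Sum.inl ⟨p, hpS⟩) ?_
      rintro (v | v) h
      · exact absurd (congrArg Sum.inl (hSp v)) h
      · exact adj1 _ _ (hall v)
    have d2 := kill_dim_ge (K := K) e1 _ he1 Sum.inr (fun w => rfl)
    rw [hCM] at d2
    have d3 : 2 * Nat.card (Fin k) ≤
        quotDepth K (binomialEdgeIdeal K (leviGraph C S)) := by exact_mod_cast d2
    rw [Nat.card_sum, hcard] at d1
    rw [Nat.card_fin] at *
    omega
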